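/- First recurrence relation (3-term recurrence): for every real q with 0 < q < 1, every positive integer N, all nonzero real numbers θ, φ, all integers n₁, n₂ ≥ 0 with n₁+n₂ ≤ N-1, and all integers x₁, x₂ ≥ 0 with x₁+x₂ ≤ N, writing K_{m₁,m₂} := K_{m₁,m₂}(x₁,x₂;θ,φ;N) (with K := 0 if a degree index is negative), one has q^{-x₁-x₂} K_{n₁,n₂} = q^{-(n₁+2n₂+1)}[q^{n₂+1}(1+φ²) + φ² q^{n₁+n₂-N} - (1+q)φ²] K_{n₁,n₂} + q^{-(n₁+1)}(1-q^{n₂})(1-q^{n₁+n₂-N-1})(1-φ² q^{-n₂}) K_{n₁,n₂-1} - q^{-(3n₂+n₁+1)} φ² K_{n₁,n₂+1}. -/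

import Mathlib

open Finset

/-- The q-Pochhammer symbol `(a;q)_n = ∏_{k=0}^{n-1} (1 - a q^k)`. -/
noncomputable def qPoch (q a : ℝ) (n : ℕ) : ℝ := ∏ k ∈ Finset.range n, (1 - a * q ^ k)

/-- The quantum q-Krawtchouk polynomial `k_n(x;p,N;q)`, defined for all integers `x, N`. -/
noncomputable def qKraw (q : ℝ) (n : ℕ) (x N : ℤ) (p : ℝ) : ℝ :=
  (-1 : ℝ) ^ n * q ^ (n * (n - 1) / 2) *
    ∑ k ∈ Finset.range (n + 1),
      qPoch q (q ^ (-(n : ℤ))) k * qPoch q (q ^ (-x)) k *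
        qPoch q (q ^ ((k : ℤ) - N)) (n - k) / qPoch q q k * (p * q ^ (n + 1)) ^ k

/-- The bivariate quantum q-Krawtchouk polynomial of Gasper and Rahman,
`K_{n₁,n₂}(x₁,x₂;θ,φ;N) = k_{n₁}(x₁;θ^{-2},x₁+x₂;q) k_{n₂}(x₁+x₂-n₁;φ^{-2},N-n₁;q)`,
with the convention that it vanishes when a degree index is negative. -/
noncomputable def Kq (q : ℝ) (n₁ n₂ x₁ x₂ : ℤ) (θ φ : ℝ) (N : ℤ) : ℝ :=
  if 0 ≤ n₁ ∧ 0 ≤ n₂ then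
    qKraw q n₁.toNat x₁ (x₁ + x₂) (θ ^ 2)⁻¹ *
      qKraw q n₂.toNat (x₁ + x₂ - n₁) (N - n₁) (φ ^ 2)⁻¹
  else 0

/-- The q-trinomial coefficient `[N; x₁, x₂]_q`. -/
noncomputable def qTrinom (q : ℝ) (N x₁ x₂ : ℕ) : ℝ :=
  qPoch q q N / (qPoch q q x₁ * qPoch q q x₂ * qPoch q q (N - x₁ - x₂))

/-- The orthogonality weight `Δ^{(N)}_{x₁,x₂}(θ,φ)`. -/
noncomputable def Δw (q : ℝ) (N x₁ x₂ : ℕ) (θ φ : ℝ) : ℝ :=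
  (-1 : ℝ) ^ (N - x₁) * (θ ^ 2 * q⁻¹) ^ (x₁ + x₂) * q ^ (x₁ * (x₁ - 1) / 2) *
    qTrinom q N x₁ x₂ * qPoch q ((θ ^ 2)⁻¹ * q) x₂ * qPoch q ((φ ^ 2)⁻¹ * q) (N - x₁ - x₂) *
    φ ^ (2 * N) * q ^ (-((N : ℤ) * (N + 1) / 2))

/-- The normalization constant `H^{(N)}_{n₁,n₂}(θ,φ)`. -/
noncomputable def Hn (q : ℝ) (N n₁ n₂ : ℕ) (θ φ : ℝ) : ℝ :=
  (-1 : ℝ) ^ (n₁ + n₂) * qPoch q (q * (θ ^ 2)⁻¹) n₁ * qPoch q (q * (φ ^ 2)⁻¹) n₂ *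
    φ ^ (2 * n₁) * (qPoch q q N / qPoch q q (N - n₁ - n₂)) ^ 2 * (qTrinom q N n₁ n₂)⁻¹ *
    q ^ (3 * ((n₁ : ℤ) * (n₁ - 1)) / 2 + 3 * ((n₂ : ℤ) * (n₂ - 1)) / 2 +
          (n₁ : ℤ) * n₂ - (N : ℤ) * (n₁ + n₂) - 2 * n₁ - n₂)

/-- The dual weight `Δ̃^{(N)}_{n₁,n₂}(θ,φ)`. -/
noncomputable def Δdual (q : ℝ) (N n₁ n₂ : ℕ) (θ φ : ℝ) : ℝ :=
  (-1 : ℝ) ^ (n₁ + n₂) * q ^ (-((n₁ : ℤ) * (n₁ - 1)) - (n₂ : ℤ) * (n₂ - 1)) *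
    φ ^ (-(2 * (n₁ : ℤ))) * (qPoch q q (N - n₁ - n₂) / qPoch q q N) ^ 2 * qTrinom q N n₁ n₂ *
    q ^ ((N : ℤ) * (n₁ + n₂) + 2 * n₁ + n₂ - (n₁ : ℤ) * n₂ -
          (n₁ : ℤ) * (n₁ - 1) / 2 - (n₂ : ℤ) * (n₂ - 1) / 2) /
    (qPoch q (q * (θ ^ 2)⁻¹) n₁ * qPoch q (q * (φ ^ 2)⁻¹) n₂)

lemma qPoch_succ (q a : ℝ) (n : ℕ) : qPoch q a (n + 1) = qPoch q a n * (1 - a * q ^ n) :=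
  Finset.prod_range_succ _ _

lemma qPoch_succ' (q a : ℝ) (n : ℕ) : qPoch q a (n + 1) = (1 - a) * qPoch q (a * q) n := by
  unfold qPoch
  rw [Finset.prod_range_succ', mul_comm]
  simp only [pow_zero, mul_one, pow_succ']
  simp only [mul_assoc]

lemma qPoch_zero (q a : ℝ) : qPoch q a 0 = 1 := Finset.prod_range_zero _

lemma qPoch_self_ne_zero {q : ℝ} (hq0 : 0 < q) (hq1 : q < 1) (n : ℕ) : qPoch q q n ≠ 0 := by
  refine Finset.prod_ne_zero_iff.2 fun k _ => ?_
  have := pow_lt_one₀ hq0.le hq1 (Nat.succ_ne_zero k)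
  rw [pow_succ'] at this
  exact (sub_pos.2 this).ne'

/-- The coefficient of `(q^{-x};q)_k` in `k_n(x;p,M;q)`, where `u = q^{-M}`. -/
noncomputable def qKrawCoeff (q u p : ℝ) (n k : ℕ) : ℝ :=
  (-1 : ℝ) ^ n * q ^ (n * (n - 1) / 2) *
    (qPoch q (q ^ n)⁻¹ k * qPoch q (u * q ^ k) (n - k) / qPoch q q k * (p * q ^ (n + 1)) ^ k)

lemma qPoch_inv_pow_eq_zero {q : ℝ} (hq : q ≠ 0) {n k : ℕ} (h : n < k) :
    qPoch q (q ^ n)⁻¹ k = 0 :=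
  Finset.prod_eq_zero (Finset.mem_range.2 h) (by
    rw [inv_mul_cancel₀ (pow_ne_zero _ hq), sub_self])

lemma qKrawCoeff_eq_zero {q : ℝ} (hq : q ≠ 0) (u p : ℝ) {n k : ℕ} (h : n < k) :
    qKrawCoeff q u p n k = 0 := by
  simp [qKrawCoeff, qPoch_inv_pow_eq_zero hq h]

lemma qKraw_eq_sum {q : ℝ} (hq : q ≠ 0) (n : ℕ) (x M : ℤ) (p : ℝ) (L : ℕ) (hL : n + 1 ≤ L) :
    qKraw q n x M p =
      ∑ k ∈ Finset.range L, qKrawCoeff q (q ^ (-M)) p n k * qPoch q (q ^ (-x)) k := by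
  rw [← Finset.sum_subset (Finset.range_subset_range.2 hL)]
  · unfold qKraw qKrawCoeff
    rw [Finset.mul_sum]
    refine Finset.sum_congr rfl fun k _ => ?_
    rw [show (k : ℤ) - M = -M + k by ring, zpow_add₀ hq, zpow_natCast, zpow_neg q (n : ℤ),
      zpow_natCast]
    ring
  · intro k _ hk
    rw [qKrawCoeff_eq_zero hq _ _ (by simpa using hk), zero_mul]

lemma pow_choose_two_succ (q : ℝ) (n : ℕ) :
    q ^ ((n + 1) * (n + 1 - 1) / 2) = q ^ (n * (n - 1) / 2) * q ^ n := by
  rw [← pow_add, Nat.triangle_succ]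

/-- Coefficient form of the three-term recurrence, at index `0`. -/
lemma qKrawCoeff_recurrence_zero {q : ℝ} (hq0 : 0 < q) (u p : ℝ) (hp : p ≠ 0) (r : ℕ) :
    qKrawCoeff q u p (r + 1) 0 =
      (q ^ (2 * (r + 1) + 1))⁻¹ * (q ^ (r + 2) * (1 + p⁻¹) + p⁻¹ * (q ^ (r + 1) * u)
          - (1 + q) * p⁻¹) * qKrawCoeff q u p (r + 1) 0
        + q⁻¹ * (1 - q ^ (r + 1)) * (1 - q ^ r * u) * (1 - p⁻¹ * (q ^ (r + 1))⁻¹) *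
          qKrawCoeff q u p r 0
        - (q ^ (3 * (r + 1) + 1))⁻¹ * p⁻¹ * qKrawCoeff q u p (r + 2) 0 := by
  have hq := hq0.ne'
  simp only [qKrawCoeff, qPoch_zero, pow_choose_two_succ, qPoch_succ, Nat.sub_zero, pow_zero,
    mul_one]
  generalize q ^ (r * (r - 1) / 2) = T
  generalize qPoch q u r = R
  simp only [pow_succ, pow_mul']
  have hQ : q ^ r ≠ 0 := pow_ne_zero _ hq
  generalize q ^ r = Q at *
  field_simp
  ring

/-- Coefficient form of the three-term recurrence, at positive index. -/
lemma qKrawCoeff_recurrence_succ {q : ℝ} (hq0 : 0 < q) (hq1 : q < 1) (u p : ℝ) (hp : p ≠ 0)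
    (r m : ℕ) (hm : m ≤ r + 1) :
    (q ^ (m + 1))⁻¹ * qKrawCoeff q u p (r + 1) (m + 1) -
        (q ^ m)⁻¹ * qKrawCoeff q u p (r + 1) m =
      (q ^ (2 * (r + 1) + 1))⁻¹ * (q ^ (r + 2) * (1 + p⁻¹) + p⁻¹ * (q ^ (r + 1) * u)
          - (1 + q) * p⁻¹) * qKrawCoeff q u p (r + 1) (m + 1)
        + q⁻¹ * (1 - q ^ (r + 1)) * (1 - q ^ r * u) * (1 - p⁻¹ * (q ^ (r + 1))⁻¹) *
          qKrawCoeff q u p r (m + 1)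
        - (q ^ (3 * (r + 1) + 1))⁻¹ * p⁻¹ * qKrawCoeff q u p (r + 2) (m + 1) := by
  have hq := hq0.ne'
  have hD := qPoch_self_ne_zero hq0 hq1 m
  have hD1 := qPoch_self_ne_zero hq0 hq1 (m + 1)
  have hQ : q ^ r ≠ 0 := pow_ne_zero _ hq
  have hK : q ^ m ≠ 0 := pow_ne_zero _ hq
  rw [qPoch_succ] at hD1
  have hE : 1 - q * q ^ m ≠ 0 := right_ne_zero_of_mul hD1
  -- the shifted Pochhammer symbols in terms of `(q^{-(r+1)};q)_m`
  have h2 : qPoch q (q ^ (r + 2))⁻¹ (m + 1) =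
      (1 - (q ^ r * q * q)⁻¹) * qPoch q (q ^ (r + 1))⁻¹ m := by
    rw [qPoch_succ']
    congr 2
    all_goals field_simp
    all_goals ring
  have h1 : qPoch q (q ^ (r + 1))⁻¹ (m + 1) =
      qPoch q (q ^ (r + 1))⁻¹ m * (1 - (q ^ r * q)⁻¹ * q ^ m) := by
    rw [qPoch_succ, pow_succ]
  have h0 : (1 - q ^ (r + 1)) * qPoch q (q ^ r)⁻¹ (m + 1) = -(q ^ r * q) *
      (qPoch q (q ^ (r + 1))⁻¹ m * (1 - (q ^ r * q)⁻¹ * q ^ m) *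
        (1 - (q ^ r * q)⁻¹ * (q ^ m * q))) := by
    have h := qPoch_succ' q (q ^ (r + 1))⁻¹ (m + 1)
    rw [qPoch_succ, h1, show (q ^ (r + 1))⁻¹ * q = (q ^ r)⁻¹ by field_simp; ring, pow_succ q r,
      pow_succ q m] at h
    rw [pow_succ q r, h]
    field_simp
    ring
  have hB : (1 - q ^ (r + 1)) * qKrawCoeff q u p r (m + 1) = -(q ^ r * q) *
      ((-1 : ℝ) ^ r * q ^ (r * (r - 1) / 2) * (qPoch q (q ^ (r + 1))⁻¹ m *
        (1 - (q ^ r * q)⁻¹ * q ^ m) * (1 - (q ^ r * q)⁻¹ * (q ^ m * q)) *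
        qPoch q (u * q ^ (m + 1)) (r - (m + 1)) / qPoch q q (m + 1) *
        (p * q ^ (r + 1)) ^ (m + 1))) := by
    unfold qKrawCoeff
    linear_combination ((-1 : ℝ) ^ r * q ^ (r * (r - 1) / 2) *
      (qPoch q (u * q ^ (m + 1)) (r - (m + 1)) / qPoch q q (m + 1) *
        (p * q ^ (r + 1)) ^ (m + 1))) * h0
  have hW (s : ℕ) : (p * q ^ (s + 1)) ^ m = (p * q) ^ m * (q ^ m) ^ s := by
    rw [← pow_mul, mul_comm m s, pow_mul, ← mul_pow]; ring
  have hDi : (qPoch q q m)⁻¹ = (1 - q * q ^ m) * (qPoch q q m * (1 - q * q ^ m))⁻¹ := by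
    field_simp
  rw [mul_assoc (q⁻¹), mul_comm (1 - q ^ (r + 1)), ← mul_assoc (q⁻¹),
    mul_right_comm (_ * _) _ (_ - _), mul_assoc _ (1 - q ^ (r + 1)), hB]
  clear hB h0
  rcases Nat.lt_or_ge m r with h | h
  · obtain ⟨j, rfl⟩ := Nat.exists_eq_add_of_lt h
    simp only [qKrawCoeff, h1, h2, pow_choose_two_succ]
    rw [show m + j + 1 + 1 - (m + 1) = j + 1 by omega, show m + j + 1 - (m + 1) = j by omega,
      show m + j + 1 + 2 - (m + 1) = j + 2 by omega, show m + j + 1 + 1 - m = j + 2 by omega,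
      qPoch_succ' q (u * q ^ m) (j + 1), show u * q ^ m * q = u * q ^ (m + 1) by ring]
    simp only [qPoch_succ, pow_succ (p * _), hW, div_eq_mul_inv, hDi]
    have hJ : q ^ j ≠ 0 := pow_ne_zero _ hq
    clear hW h1 h2 hDi hD1 hE hD hQ
    generalize qPoch q (q ^ (m + j + 1 + 1))⁻¹ m = S at *
    generalize qPoch q (u * q ^ (m + 1)) j = R at *
    generalize q ^ ((m + j) * (m + j - 1) / 2) = T
    generalize (p * q) ^ m = W
    generalize (qPoch q q m * (1 - q * q ^ m))⁻¹ = D at *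
    simp only [pow_succ, pow_add, pow_mul', mul_pow] at *
    generalize (q ^ m) ^ m = X at *
    generalize (q ^ m) ^ j = Y at *
    generalize q ^ m = K at *
    generalize q ^ j = J at *
    field_simp
    ring
  rcases h.eq_or_lt with rfl | h
  · simp only [qKrawCoeff, h1, h2, pow_choose_two_succ]
    rw [Nat.sub_self, Nat.sub_eq_zero_of_le (Nat.le_succ r), show r + 2 - (r + 1) = 1 by omega,
      show r + 1 - r = 1 by omega]
    simp only [qPoch_zero, qPoch_succ, pow_succ (p * _), hW, div_eq_mul_inv, hDi]
    clear hW h1 h2 hDi hD1 hE hD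
    generalize (qPoch q q r * (1 - q * q ^ r))⁻¹ = D at *
    simp only [pow_succ, pow_mul', mul_pow] at *
    generalize (q ^ r) ^ r = X at *
    generalize q ^ r = K at *
    field_simp
    ring
  · obtain rfl : m = r + 1 := by omega
    simp only [qKrawCoeff, h1, h2, pow_choose_two_succ]
    rw [Nat.sub_self, Nat.sub_eq_zero_of_le (show r + 1 ≤ r + 1 + 1 by omega),
      Nat.sub_eq_zero_of_le (show r ≤ r + 1 + 1 by omega),
      show r + 2 - (r + 1 + 1) = 0 by omega]
    simp only [qPoch_zero, pow_succ (p * _), div_eq_mul_inv]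
    rw [qPoch_succ q q (r + 1)]
    simp only [hDi]
    clear hW h1 h2 hDi hD1 hE hD
    generalize (qPoch q q (r + 1) * (1 - q * q ^ (r + 1)))⁻¹ = D at *
    generalize (p * q) ^ (r + 1) = W
    generalize qPoch q (q ^ (r + 1))⁻¹ (r + 1) = S
    simp only [pow_succ, pow_mul', mul_pow] at *
    generalize (q ^ r) ^ r = X at *
    generalize q ^ r = K at *
    field_simp
    ring

/-- Three-term recurrence in the degree for the quantum q-Krawtchouk polynomials. -/
lemma qKraw_recurrence_succ {q : ℝ} (hq0 : 0 < q) (hq1 : q < 1) (x M : ℤ) (p : ℝ) (hp : p ≠ 0)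
    (r : ℕ) :
    q ^ (-x) * qKraw q (r + 1) x M p =
      (q ^ (2 * (r + 1) + 1))⁻¹ * (q ^ (r + 2) * (1 + p⁻¹) + p⁻¹ * (q ^ (r + 1) * q ^ (-M))
          - (1 + q) * p⁻¹) * qKraw q (r + 1) x M p
        + q⁻¹ * (1 - q ^ (r + 1)) * (1 - q ^ r * q ^ (-M)) * (1 - p⁻¹ * (q ^ (r + 1))⁻¹) *
          qKraw q r x M p
        - (q ^ (3 * (r + 1) + 1))⁻¹ * p⁻¹ * qKraw q (r + 2) x M p := by
  have hq := hq0.ne'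
  generalize hA : (q ^ (2 * (r + 1) + 1))⁻¹ * (q ^ (r + 2) * (1 + p⁻¹) +
    p⁻¹ * (q ^ (r + 1) * q ^ (-M)) - (1 + q) * p⁻¹) = A
  generalize hB : q⁻¹ * (1 - q ^ (r + 1)) * (1 - q ^ r * q ^ (-M)) *
    (1 - p⁻¹ * (q ^ (r + 1))⁻¹) = B
  generalize hC : (q ^ (3 * (r + 1) + 1))⁻¹ * p⁻¹ = C
  have h0 := qKrawCoeff_recurrence_zero hq0 (q ^ (-M)) p hp r
  have hs := qKrawCoeff_recurrence_succ hq0 hq1 (q ^ (-M)) p hp r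
  rw [hA, hB, hC] at h0
  simp only [hA, hB, hC] at hs
  have hmul : q ^ (-x) * qKraw q (r + 1) x M p = ∑ k ∈ Finset.range (r + 2),
      ((q ^ k)⁻¹ * qKrawCoeff q (q ^ (-M)) p (r + 1) k * qPoch q (q ^ (-x)) k -
        (q ^ k)⁻¹ * qKrawCoeff q (q ^ (-M)) p (r + 1) k * qPoch q (q ^ (-x)) (k + 1)) := by
    rw [qKraw_eq_sum hq (r + 1) x M p (r + 2) le_rfl, Finset.mul_sum]
    refine Finset.sum_congr rfl fun k _ => ?_
    rw [qPoch_succ]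
    field_simp
    ring
  have hext : ∑ k ∈ Finset.range (r + 2),
      (q ^ k)⁻¹ * qKrawCoeff q (q ^ (-M)) p (r + 1) k * qPoch q (q ^ (-x)) k =
      ∑ k ∈ Finset.range (r + 2), (q ^ (k + 1))⁻¹ * qKrawCoeff q (q ^ (-M)) p (r + 1) (k + 1) *
        qPoch q (q ^ (-x)) (k + 1) + qKrawCoeff q (q ^ (-M)) p (r + 1) 0 := by
    have h := Finset.sum_range_succ (fun k =>
      (q ^ k)⁻¹ * qKrawCoeff q (q ^ (-M)) p (r + 1) k * qPoch q (q ^ (-x)) k) (r + 2)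
    rw [Finset.sum_range_succ', qKrawCoeff_eq_zero hq _ _ (Nat.lt_succ_self (r + 1))] at h
    simpa [qPoch_zero] using h.symm
  rw [hmul, Finset.sum_sub_distrib, hext, add_sub_right_comm, ← Finset.sum_sub_distrib,
    qKraw_eq_sum hq (r + 1) x M p (r + 3) (by omega), qKraw_eq_sum hq r x M p (r + 3) (by omega),
    qKraw_eq_sum hq (r + 2) x M p (r + 3) le_rfl, Finset.mul_sum, Finset.mul_sum, Finset.mul_sum,
    ← Finset.sum_add_distrib, ← Finset.sum_sub_distrib, Finset.sum_range_succ' _ (r + 2),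
    qPoch_zero]
  congr 1
  · refine Finset.sum_congr rfl fun k hk => ?_
    linear_combination qPoch q (q ^ (-x)) (k + 1) * hs k (by
      have := Finset.mem_range.1 hk
      omega)
  · linear_combination h0

lemma qKraw_recurrence_zero {q : ℝ} (hq0 : 0 < q) (hq1 : q < 1) (x M : ℤ) (p : ℝ) (hp : p ≠ 0) :
    q ^ (-x) * qKraw q 0 x M p =
      q⁻¹ * (q * (1 + p⁻¹) + p⁻¹ * q ^ (-M) - (1 + q) * p⁻¹) * qKraw q 0 x M p
        - q⁻¹ * p⁻¹ * qKraw q 1 x M p := by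
  have hq := hq0.ne'
  have hq1' : 1 - q ≠ 0 := (sub_pos.2 hq1).ne'
  rw [qKraw_eq_sum hq 0 x M p 1 le_rfl, qKraw_eq_sum hq 1 x M p 2 le_rfl]
  simp only [Finset.sum_range_succ, Finset.sum_range_zero, qKrawCoeff, qPoch,
    Finset.prod_range_succ, Finset.prod_range_zero]
  norm_num
  field_simp
  ring

/-- First recurrence relation (3-term recurrence in the degree indices,
with the convention that `K` with a negative degree index vanishes). -/
theorem first_recurrence (q : ℝ) (hq0 : 0 < q) (hq1 : q < 1)
    (N : ℕ) (hN : 0 < N) (θ φ : ℝ) (hθ : θ ≠ 0) (hφ : φ ≠ 0)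
    (n₁ n₂ : ℕ) (hn : n₁ + n₂ ≤ N - 1) (x₁ x₂ : ℕ) (hx : x₁ + x₂ ≤ N) :
    q ^ (-(x₁ : ℤ) - x₂) * Kq q n₁ n₂ x₁ x₂ θ φ N
    = q ^ (-((n₁ : ℤ) + 2 * n₂ + 1)) *
        (q ^ (n₂ + 1) * (1 + φ ^ 2) + φ ^ 2 * q ^ ((n₁ : ℤ) + n₂ - N) - (1 + q) * φ ^ 2) *
        Kq q n₁ n₂ x₁ x₂ θ φ N
      + q ^ (-((n₁ : ℤ) + 1)) * (1 - q ^ n₂) * (1 - q ^ ((n₁ : ℤ) + n₂ - N - 1)) *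
        (1 - φ ^ 2 * q ^ (-(n₂ : ℤ))) * Kq q n₁ ((n₂ : ℤ) - 1) x₁ x₂ θ φ N
      - q ^ (-(3 * (n₂ : ℤ) + n₁ + 1)) * φ ^ 2 * Kq q n₁ (n₂ + 1) x₁ x₂ θ φ N := by
  have hq := hq0.ne'
  have hp : (φ ^ 2)⁻¹ ≠ 0 := inv_ne_zero (pow_ne_zero 2 hφ)
  have hK (m : ℕ) : Kq q n₁ m x₁ x₂ θ φ N = qKraw q n₁ x₁ (x₁ + x₂) (θ ^ 2)⁻¹ *
      qKraw q m (x₁ + x₂ - n₁) (N - n₁) (φ ^ 2)⁻¹ := by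
    simp [Kq]
  have hX : q ^ (-(x₁ : ℤ) - x₂) = q ^ (-(n₁ : ℤ)) * q ^ (-((x₁ : ℤ) + x₂ - n₁)) := by
    rw [← zpow_add₀ hq]
    congr 1
    ring
  have hN' (n : ℕ) : q ^ ((n₁ : ℤ) + n - N) = q ^ n * q ^ (-((N : ℤ) - n₁)) := by
    rw [← zpow_natCast, ← zpow_add₀ hq]
    congr 1
    ring
  cases n₂ with
  | zero =>
    have h := qKraw_recurrence_zero hq0 hq1 (x₁ + x₂ - n₁) (N - n₁) (φ ^ 2)⁻¹ hp
    rw [inv_inv] at h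
    have h1 := hK (0 + 1)
    push_cast at h1
    have hA : q ^ (-((n₁ : ℤ) + 2 * (0 : ℕ) + 1)) = q ^ (-(n₁ : ℤ)) * q⁻¹ := by
      rw [← zpow_neg_one, ← zpow_add₀ hq]
      congr 1
      push_cast
      ring
    have hC : q ^ (-(3 * ((0 : ℕ) : ℤ) + n₁ + 1)) = q ^ (-(n₁ : ℤ)) * q⁻¹ := by
      rw [← zpow_neg_one, ← zpow_add₀ hq]
      congr 1
      push_cast
      ring
    rw [hX, hN', hA, hC, hK]
    push_cast
    rw [h1]
    linear_combination q ^ (-(n₁ : ℤ)) * qKraw q n₁ x₁ (x₁ + x₂) (θ ^ 2)⁻¹ * h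
  | succ r =>
    have h := qKraw_recurrence_succ hq0 hq1 (x₁ + x₂ - n₁) (N - n₁) (φ ^ 2)⁻¹ hp r
    rw [inv_inv] at h
    have h2 : Kq q n₁ (((r + 1 : ℕ) : ℤ) + 1) x₁ x₂ θ φ N = _ := hK (r + 1 + 1)
    have h0 := hK r
    rw [show (r : ℤ) = ((r + 1 : ℕ) : ℤ) - 1 by push_cast; ring] at h0
    have hA : q ^ (-((n₁ : ℤ) + 2 * (r + 1 : ℕ) + 1)) =
        q ^ (-(n₁ : ℤ)) * (q ^ (2 * (r + 1) + 1))⁻¹ := by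
      rw [← zpow_natCast, ← zpow_neg, ← zpow_add₀ hq]
      congr 1
      push_cast
      ring
    have hC : q ^ (-(3 * ((r + 1 : ℕ) : ℤ) + n₁ + 1)) =
        q ^ (-(n₁ : ℤ)) * (q ^ (3 * (r + 1) + 1))⁻¹ := by
      rw [← zpow_natCast, ← zpow_neg, ← zpow_add₀ hq]
      congr 1
      push_cast
      ring
    have hB : q ^ (-((n₁ : ℤ) + 1)) = q ^ (-(n₁ : ℤ)) * q⁻¹ := by
      rw [← zpow_neg_one, ← zpow_add₀ hq]
      congr 1
      ring
    have hM : q ^ ((n₁ : ℤ) + (r + 1 : ℕ) - N - 1) = q ^ r * q ^ (-((N : ℤ) - n₁)) := by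
      rw [← hN']
      congr 1
      push_cast
      ring
    rw [hX, hN', hA, hB, hC, hM, hK, h0, h2, zpow_neg q ((r + 1 : ℕ) : ℤ), zpow_natCast]
    linear_combination q ^ (-(n₁ : ℤ)) * qKraw q n₁ x₁ (x₁ + x₂) (θ ^ 2)⁻¹ * h
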